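/- Assume the Continuum Hypothesis (2^ℵ₀ = ℵ₁). Let O ⊆ ℝ × ℝ be an open symmetric set, and let X ⊆ ℝ be a set that is not the union of countably many sets Y with [Y]² ∩ O = ∅. Then there exists a subset X' ⊆ X of cardinality ℵ₁ such that the partial order of finite subsets a ⊆ X' with [a]² ⊆ O, ordered by reverse inclusion, satisfies the countable chain condition: every family of pairwise incompatible conditions (a, b incompatible iff [a ∪ b]² ⊄ O) is countable. -/

import Mathlib

/-- `[Y]²`: the set of pairs `(x, y)` with `x, y ∈ Y` and `x ≠ y`. -/
def pairsSq (Y : Set ℝ) : Set (ℝ × ℝ) := {p | p.1 ∈ Y ∧ p.2 ∈ Y ∧ p.1 ≠ p.2}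

/-- A condition of the forcing associated to `O` and `X'`: a finite subset `a ⊆ X'`
with `[a]² ⊆ O` (i.e. `a` is `O`-homogeneous). -/
def IsCond (O : Set (ℝ × ℝ)) (X' : Set ℝ) (a : Finset ℝ) : Prop :=
  (↑a : Set ℝ) ⊆ X' ∧ pairsSq (↑a) ⊆ O

open Cardinal Set TopologicalSpace in
/-- Under CH the sets of natural numbers can be indexed, together with a natural number, by a
well-order of type `ω₁`. -/
theorem exists_wellOrder_of_continuum_eq_aleph_one.{u}
    (hCH : Cardinal.continuum.{u} = Cardinal.aleph 1) :
    ∃ (I : Type) (_ : LinearOrder I) (_ : WellFoundedLT I) (e : ℕ × Set ℕ → I),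
      #I = Cardinal.aleph 1 ∧ (∀ i : I, (Iio i).Countable) ∧ Function.Injective e := by
  have hK : #(ℕ × Set ℕ) = #(ord (Cardinal.aleph 1)).ToType := by
    have h₀ : Cardinal.continuum.{0} = Cardinal.aleph 1 := by
      apply lift_injective.{u, 0}
      simpa using hCH
    rw [mk_ord_toType, ← h₀]
    simp
  obtain ⟨e⟩ := Cardinal.eq.1 hK
  have hIio (i : (ord (Cardinal.aleph 1)).ToType) : (Iio i).Countable := by
    have h : #(Iio i) < Order.succ ℵ₀ := by
      rw [succ_aleph0]
      simpa using mk_Iio_lt i (by simp)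
    exact le_aleph0_iff_set_countable.1 (Order.lt_succ_iff.1 h)
  exact ⟨(ord (Cardinal.aleph 1)).ToType, inferInstance, inferInstance, e, by simp,
    hIio, e.injective⟩

open Set TopologicalSpace in
/-- In a second countable space the closed sets can be coded by sets of natural numbers. -/
theorem exists_closed_coding (α : Type*) [TopologicalSpace α] [SecondCountableTopology α] :
    ∃ C : Set ℕ → Set α, ∀ F : Set α, IsClosed F → ∃ s, C s = F := by
  obtain ⟨b, hbc, -, hb⟩ := exists_countable_basis α
  obtain ⟨f, hf⟩ := (hbc.insert ∅).exists_eq_range (insert_nonempty _ _)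
  refine ⟨fun s => (⋃ k ∈ s, f k)ᶜ, fun F hF => ⟨{k | f k ⊆ Fᶜ}, ?_⟩⟩
  rw [compl_eq_comm]
  refine Subset.antisymm ?_ (iUnion₂_subset fun k hk => hk)
  intro p hp
  obtain ⟨u, hu, hpu, huF⟩ := hb.mem_nhds_iff.1 (hF.isOpen_compl.mem_nhds hp)
  have : u ∈ range f := hf ▸ mem_insert_of_mem _ hu
  obtain ⟨k, rfl⟩ := this
  exact mem_iUnion₂.2 ⟨k, huF, hpu⟩

/-- A set is `O`-avoiding if no pair of its points, equal or not, lies in `O`. -/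
def Avoids {α : Type*} (O : Set (α × α)) (Y : Set α) : Prop :=
  ∀ y ∈ Y, ∀ z ∈ Y, (y, z) ∉ O

open Set in
/-- A set that is not a countable union of `O`-free sets is not covered by countably many sets
without off-diagonal pairs in `O`. -/
theorem exists_mem_forall_notMem_of_countable {O : Set (ℝ × ℝ)} {X : Set ℝ}
    (hX : ¬ ∃ Y : ℕ → Set ℝ, X = (⋃ n, Y n) ∧ ∀ n, pairsSq (Y n) ∩ O = ∅)
    {c : Set (Set ℝ)} (hc : c.Countable) (hfree : ∀ Y ∈ c, Avoids (O \ diagonal ℝ) Y) :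
    ∃ x ∈ X, ∀ Y ∈ c, x ∉ Y := by
  by_contra! h
  obtain ⟨f, hf⟩ := (hc.insert ∅).exists_eq_range (insert_nonempty _ _)
  refine hX ⟨fun n => X ∩ f n, ?_, fun n => ?_⟩
  · refine Subset.antisymm (fun x hx => ?_) (iUnion_subset fun n => inter_subset_left)
    obtain ⟨Y, hY, hxY⟩ := h x hx
    have : Y ∈ range f := hf ▸ mem_insert_of_mem _ hY
    obtain ⟨n, rfl⟩ := this
    exact mem_iUnion.2 ⟨n, hx, hxY⟩
  · refine eq_empty_iff_forall_notMem.2 fun p ⟨⟨h₁, h₂, hne⟩, hp⟩ => ?_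
    have hfn : f n ∈ insert ∅ c := hf ▸ mem_range_self n
    rcases hfn with h0 | hfn
    · exact notMem_empty _ (h0 ▸ h₁.2)
    · exact hfree _ hfn _ h₁.2 _ h₂.2 ⟨hp, hne⟩

open Set in
/-- Recursive choice of points that avoid a countable family of small sets depending on the
points chosen before. -/
theorem exists_wellFounded_choice {I β : Type*} [LinearOrder I] [WellFoundedLT I]
    {P : Set β} {c : (i : I) → (Iio i → β) → Set (Set β)}
    (h : ∀ i p, ∃ x ∈ P, ∀ Y ∈ c i p, x ∉ Y) :
    ∃ x : I → β, ∀ i, x i ∈ P ∧ ∀ Y ∈ c i (fun j => x j), x i ∉ Y := by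
  choose g hgP hg using h
  let x : I → β := WellFounded.fix (wellFounded_lt (α := I))
    fun i rec => g i fun j => rec j.1 j.2
  have hx : ∀ i, x i = g i fun j => x j := fun i => WellFounded.fix_eq _ _ i
  refine ⟨x, fun i => ?_⟩
  rw [hx i]
  exact ⟨hgP _ _, hg _ _⟩

/-- `x` is generic for `O` if, for every closed set `C`, no sufficiently late value `x i` lies in
an `O`-avoiding section of `C` over a tuple of earlier values. -/
def GenericFor {I : Type*} [LinearOrder I] (O : Set (ℝ × ℝ)) (x : I → ℝ) : Prop :=
  ∀ (n : ℕ) (C : Set ((Fin n → ℝ) × ℝ)), IsClosed C → ∃ k : I, ∀ i, k < i →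
    ∀ b : Fin n → I, (∀ j, b j < i) → (x ∘ b, x i) ∈ C → ¬ Avoids O {y | (x ∘ b, y) ∈ C}

open Set in
theorem exists_injective_genericFor {O : Set (ℝ × ℝ)} {X : Set ℝ}
    (hX : ¬ ∃ Y : ℕ → Set ℝ, X = (⋃ n, Y n) ∧ ∀ n, pairsSq (Y n) ∩ O = ∅)
    {I : Type*} [LinearOrder I] [WellFoundedLT I] (hI : ∀ i : I, (Iio i).Countable)
    {e : ℕ × Set ℕ → I} (he : Function.Injective e) :
    ∃ x : I → ℝ, Function.Injective x ∧ (∀ i, x i ∈ X) ∧ GenericFor (O \ diagonal ℝ) x := by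
  choose C hC using fun n : ℕ => exists_closed_coding ((Fin n → ℝ) × ℝ)
  let sec (i : I) (p : Iio i → ℝ) : (Σ q : {q : ℕ × Set ℕ // e q < i}, Fin q.1.1 → Iio i) → Set ℝ :=
    fun w => {y | (p ∘ w.2, y) ∈ C w.1.1.1 w.1.1.2}
  let c (i : I) (p : Iio i → ℝ) : Set (Set ℝ) :=
    range (fun j => {p j}) ∪ {Y ∈ range (sec i p) | Avoids (O \ diagonal ℝ) Y}
  have hc : ∀ i p, (c i p).Countable := by
    intro i p
    have : Countable (Iio i) := (hI i).to_subtype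
    have : Countable {q : ℕ × Set ℕ // e q < i} :=
      Function.Injective.countable (f := fun q => (⟨e q.1, q.2⟩ : Iio i))
        fun q r h => Subtype.ext (he (congrArg Subtype.val h))
    exact (countable_range _).union ((countable_range _).mono (sep_subset _ _))
  have hfree : ∀ i p, ∀ Y ∈ c i p, Avoids (O \ diagonal ℝ) Y := by
    rintro i p Y (⟨j, rfl⟩ | hY)
    · rintro y rfl z rfl h
      exact h.2 rfl
    · exact hY.2
  obtain ⟨x, hx⟩ := exists_wellFounded_choice (P := X) (c := c) fun i p =>
    exists_mem_forall_notMem_of_countable hX (hc i p) (hfree i p)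
  have hne : ∀ i j, j < i → x i ≠ x j := fun i j hj =>
    (hx i).2 {x j} (Or.inl ⟨⟨j, hj⟩, rfl⟩)
  refine ⟨x, fun i j hij => ?_, fun i => (hx i).1, fun n F hF => ?_⟩
  · by_contra h
    rcases lt_or_gt_of_ne h with h | h
    · exact hne _ _ h hij.symm
    · exact hne _ _ h hij
  · obtain ⟨s, rfl⟩ := hC n F hF
    refine ⟨e (n, s), fun i hi b hb hmem hav => ?_⟩
    exact (hx i).2 _ (Or.inr ⟨⟨⟨⟨(n, s), hi⟩, fun j => ⟨b j, hb j⟩⟩, rfl⟩, hav⟩) hmem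

open Set in
/-- A map from an uncountable set to a countable one has an uncountable fibre. -/
theorem exists_not_countable_fiber {τ κ : Type*} {S : Set τ} (hS : ¬ S.Countable)
    {K : Set κ} (hK : K.Countable) {r : τ → κ → Prop} (h : ∀ t ∈ S, ∃ k ∈ K, r t k) :
    ∃ k ∈ K, ¬ {t ∈ S | r t k}.Countable := by
  by_contra! hcon
  refine hS ((hK.biUnion hcon).mono fun t ht => ?_)
  obtain ⟨k, hk, hr⟩ := h t ht
  exact mem_iUnion₂.2 ⟨k, hk, ht, hr⟩

open Set TopologicalSpace in
theorem GenericFor.exists_forall_mem {I τ : Type*} [LinearOrder I] {O : Set (ℝ × ℝ)}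
    (hO : IsOpen O) {x : I → ℝ} (hx : GenericFor O x) (n : ℕ) :
    ∀ (S : Set τ) (a : τ → Fin n → I), ¬ S.Countable → (∀ t ∈ S, StrictMono (a t)) →
      (∀ k, {t ∈ S | ∃ i, a t i ≤ k}.Countable) →
      ∃ s ∈ S, ∃ t ∈ S, ∀ i, (x (a s i), x (a t i)) ∈ O := by
  induction n with
  | zero =>
    intro S a hS _ _
    obtain ⟨t, ht⟩ : S.Nonempty := nonempty_iff_ne_empty.2 fun h => hS (h ▸ countable_empty)
    exact ⟨t, ht, t, ht, fun i => i.elim0⟩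
  | succ n ih =>
    intro S a hS hmono hinf
    let pt (t : τ) : (Fin n → ℝ) × ℝ := (x ∘ Fin.init (a t), x (a t (Fin.last n)))
    obtain ⟨k, hk⟩ := hx n (closure (pt '' S)) isClosed_closure
    have hS₁ : ¬ {t ∈ S | ∀ i, k < a t i}.Countable := fun h => hS <| by
      refine ((hinf k).union h).mono fun t ht => ?_
      by_cases h' : ∃ i, a t i ≤ k
      · exact Or.inl ⟨ht, h'⟩
      · exact Or.inr ⟨ht, by simpa using h'⟩
    let B := countableBasis ℝ
    let r (t : τ) (V : Set ℝ × Set ℝ) : Prop := V.1 ×ˢ V.2 ⊆ O ∧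
      (∃ y ∈ V.1, (x ∘ Fin.init (a t), y) ∈ closure (pt '' S)) ∧
      ∃ y ∈ V.2, (x ∘ Fin.init (a t), y) ∈ closure (pt '' S)
    have hr : ∀ t ∈ {t ∈ S | ∀ i, k < a t i}, ∃ V ∈ B ×ˢ B, r t V := by
      rintro t ⟨ht, hkt⟩
      have := hk (a t (Fin.last n)) (hkt _) (Fin.init (a t))
        (fun j => hmono t ht (Fin.castSucc_lt_last j)) (subset_closure ⟨t, ht, rfl⟩)
      simp only [Avoids, not_forall, not_not] at this
      obtain ⟨y, hy, z, hz, hyz⟩ := this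
      obtain ⟨u, v, hu, hv, hyu, hzv, huv⟩ := isOpen_prod_iff.1 hO y z hyz
      obtain ⟨V, hV, hyV, hVu⟩ := (isBasis_countableBasis ℝ).mem_nhds_iff.1 (hu.mem_nhds hyu)
      obtain ⟨W, hW, hzW, hWv⟩ := (isBasis_countableBasis ℝ).mem_nhds_iff.1 (hv.mem_nhds hzv)
      exact ⟨(V, W), ⟨hV, hW⟩, (prod_mono hVu hWv).trans huv, ⟨y, hyV, hy⟩, ⟨z, hzW, hz⟩⟩
    obtain ⟨⟨V, W⟩, ⟨hV, hW⟩, hS₂⟩ := exists_not_countable_fiber hS₁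
      ((countable_countableBasis ℝ).prod (countable_countableBasis ℝ)) hr
    obtain ⟨s, ⟨-, hVW, ⟨y, hyV, hy⟩, -⟩, t, ⟨-, -, -, ⟨z, hzW, hz⟩⟩, hst⟩ :=
      ih {t ∈ {t ∈ S | ∀ i, k < a t i} | r t (V, W)} (fun t => Fin.init (a t)) hS₂
        (fun t ht => (hmono t ht.1.1).comp Fin.strictMono_castSucc)
        (fun k => (hinf k).mono (by rintro t ⟨ht, i, hi⟩; exact ⟨ht.1.1, i.castSucc, hi⟩))
    have hD : IsOpen {p : (Fin n → ℝ) × (Fin n → ℝ) | ∀ i, (p.1 i, p.2 i) ∈ O} := by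
      simp only [ofPred_forall]
      exact isOpen_iInter_of_finite fun i => hO.preimage (by fun_prop)
    obtain ⟨u, v, hu, hv, hsu, htv, huv⟩ := isOpen_prod_iff.1 hD _ _ hst
    obtain ⟨_, ⟨hs₁, hs₂⟩, s', hs', rfl⟩ := mem_closure_iff.1 hy (u ×ˢ V)
      (hu.prod (isOpen_of_mem_countableBasis hV)) ⟨hsu, hyV⟩
    obtain ⟨_, ⟨ht₁, ht₂⟩, t', ht', rfl⟩ := mem_closure_iff.1 hz (v ×ˢ W)
      (hv.prod (isOpen_of_mem_countableBasis hW)) ⟨htv, hzW⟩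
    refine ⟨s', hs', t', ht', fun i => ?_⟩
    have huv' := huv (mk_mem_prod hs₁ ht₁)
    refine Fin.lastCases ?_ (fun j => huv' j) i
    exact hVW (mk_mem_prod hs₂ ht₂)

open Set in
theorem GenericFor.exists_ne_forall_eq_or_mem {I τ : Type*} [LinearOrder I]
    (hI : ∀ i : I, (Iio i).Countable) {O : Set (ℝ × ℝ)} (hO : IsOpen O)
    (hdiag : ∀ y, (y, y) ∉ O) {x : I → ℝ} (hx : GenericFor O x) (n : ℕ) :
    ∀ (S : Set τ) (a : τ → Fin n → I), ¬ S.Countable → (∀ t ∈ S, StrictMono (a t)) →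
      InjOn a S →
      ∃ s ∈ S, ∃ t ∈ S, s ≠ t ∧ ∀ i, a s i = a t i ∨ (x (a s i), x (a t i)) ∈ O := by
  induction n with
  | zero =>
    intro S a hS _ hinj
    exact absurd (Set.Subsingleton.countable fun s hs t ht =>
      hinj hs ht (Subsingleton.elim _ _)) hS
  | succ n ih =>
    intro S a hS hmono hinj
    by_cases hinf : ∀ k, {t ∈ S | ∃ i, a t i ≤ k}.Countable
    · obtain ⟨s, hs, t, ht, hst⟩ := hx.exists_forall_mem hO (n + 1) S a hS hmono hinf
      exact ⟨s, hs, t, ht, fun h => hdiag _ (h ▸ hst 0), fun i => Or.inr (hst i)⟩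
    · push Not at hinf
      obtain ⟨k, hk⟩ := hinf
      have hIic : (Iic k).Countable := by
        rw [← Iio_insert]
        exact (hI k).insert k
      obtain ⟨j, -, hj⟩ := exists_not_countable_fiber hk hIic
        (r := fun t j => a t 0 = j) fun t ⟨ht, i, hi⟩ =>
          ⟨a t 0, ((hmono t ht).monotone (Fin.zero_le i)).trans hi, rfl⟩
      obtain ⟨s, hs, t, ht, hne, hst⟩ := ih _ (fun t => Fin.tail (a t)) hj
        (fun t ht => (hmono t ht.1.1).comp (Fin.strictMono_succ))
        (fun s hs t ht h => hinj hs.1.1 ht.1.1 <| by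
          rw [← Fin.cons_self_tail (a s), ← Fin.cons_self_tail (a t), hs.2, ht.2]
          exact congrArg _ h)
      exact ⟨s, hs.1.1, t, ht.1.1, hne,
        fun i => Fin.cases (Or.inl (hs.2.trans ht.2.symm)) hst i⟩

open Set TopologicalSpace in
theorem GenericFor.countable_of_antichain {I : Type*} [LinearOrder I]
    (hI : ∀ i : I, (Iio i).Countable) {O : Set (ℝ × ℝ)} (hO : IsOpen O)
    (hsym : ∀ x y : ℝ, (x, y) ∈ O → (y, x) ∈ O) {x : I → ℝ} (hinj : Function.Injective x)
    (hx : GenericFor (O \ diagonal ℝ) x) {A : Set (Finset ℝ)}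
    (hA : ∀ a ∈ A, IsCond O (range x) a)
    (hanti : ∀ a ∈ A, ∀ b ∈ A, a ≠ b → ¬ pairsSq (↑(a ∪ b)) ⊆ O) : A.Countable := by
  by_contra hunc
  have hfin : ∀ a ∈ A, ∃ n ∈ (univ : Set ℕ),
      ∃ g : Fin n → I, StrictMono g ∧ range (x ∘ g) = (a : Set ℝ) := by
    intro a ha
    let J : Finset I := a.preimage x hinj.injOn
    refine ⟨J.card, mem_univ _, J.orderEmbOfFin rfl, (J.orderEmbOfFin rfl).strictMono, ?_⟩
    rw [range_comp, Finset.range_orderEmbOfFin, Finset.coe_preimage,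
      image_preimage_eq_of_subset (hA a ha).1]
  obtain ⟨n, -, hn⟩ := exists_not_countable_fiber hunc countable_univ hfin
  have : ∀ a : {a // a ∈ A ∧ ∃ g : Fin n → I, StrictMono g ∧ range (x ∘ g) = (a : Set ℝ)},
      ∃ g : Fin n → I, StrictMono g ∧ range (x ∘ g) = (a.1 : Set ℝ) := fun a => a.2.2
  choose g hg hgr using this
  have hD : IsOpen {p : (Fin n → ℝ) × (Fin n → ℝ) | ∀ i j, i ≠ j → (p.1 i, p.2 j) ∈ O} := by
    simp only [ofPred_forall]
    exact isOpen_iInter_of_finite fun i => isOpen_iInter_of_finite fun j =>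
      isOpen_iInter_of_finite fun _ => hO.preimage (by fun_prop)
  have hU : ∀ a ∈ (univ : Set {a // a ∈ A ∧ ∃ g : Fin n → I, StrictMono g ∧
      range (x ∘ g) = (a : Set ℝ)}), ∃ U ∈ countableBasis (Fin n → ℝ), x ∘ g a ∈ U ∧
      ∀ p ∈ U, ∀ q ∈ U, ∀ i j, i ≠ j → (p i, q j) ∈ O := by
    intro a _
    have hmem : (x ∘ g a, x ∘ g a) ∈
        {p : (Fin n → ℝ) × (Fin n → ℝ) | ∀ i j, i ≠ j → (p.1 i, p.2 j) ∈ O} := by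
      intro i j hij
      refine (hA a.1 a.2.1).2 ⟨?_, ?_, fun h => hij ((hg a).injective (hinj h))⟩
      · rw [← hgr a]
        exact mem_range_self i
      · rw [← hgr a]
        exact mem_range_self j
    obtain ⟨u, v, hu, hv, hau, hav, huv⟩ := isOpen_prod_iff.1 hD _ _ hmem
    obtain ⟨U, hU, haU, hUuv⟩ := (isBasis_countableBasis _).mem_nhds_iff.1
      ((hu.inter hv).mem_nhds ⟨hau, hav⟩)
    exact ⟨U, hU, haU, fun p hp q hq => @huv (p, q) ⟨(hUuv hp).1, (hUuv hq).2⟩⟩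
  have huniv : ¬ (univ : Set {a // a ∈ A ∧ ∃ g : Fin n → I, StrictMono g ∧
      range (x ∘ g) = (a : Set ℝ)}).Countable := fun h =>
    hn (countable_coe_iff.1 (countable_univ_iff.1 h))
  obtain ⟨U, -, hUS⟩ := exists_not_countable_fiber huniv (countable_countableBasis _) hU
  have hO' : IsOpen (O \ diagonal ℝ) := hO.sdiff isClosed_diagonal
  obtain ⟨s, hs, t, ht, hne, hst⟩ := hx.exists_ne_forall_eq_or_mem hI hO' (fun y h => h.2 rfl) n
    _ g hUS (fun t _ => hg t) (fun s _ t _ h => Subtype.ext <| Finset.coe_injective <| by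
      rw [← hgr s, ← hgr t, h])
  have hcross : ∀ p ∈ s.1, ∀ q ∈ t.1, p ≠ q → (p, q) ∈ O := by
    intro p hp q hq hpq
    rw [← Finset.mem_coe, ← hgr] at hp hq
    obtain ⟨i, rfl⟩ := hp
    obtain ⟨j, rfl⟩ := hq
    by_cases hij : i = j
    · subst hij
      rcases hst i with h | h
      · exact absurd (congrArg x h) hpq
      · exact h.1
    · exact hs.2.2 _ hs.2.1 _ ht.2.1 i j hij
  refine hanti s.1 s.2.1 t.1 t.2.1 (fun h => hne (Subtype.ext h)) ?_
  rintro ⟨p, q⟩ ⟨hp, hq, hpq⟩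
  rcases Finset.mem_union.1 (Finset.mem_coe.1 hp) with hp | hp <;>
    rcases Finset.mem_union.1 (Finset.mem_coe.1 hq) with hq | hq
  · exact (hA _ s.2.1).2 ⟨hp, hq, hpq⟩
  · exact hcross p hp q hq hpq
  · exact hsym _ _ (hcross q hq p hp (Ne.symm hpq))
  · exact (hA _ t.2.1).2 ⟨hp, hq, hpq⟩

/-- Assume CH (`2^ℵ₀ = ℵ₁`). If `O ⊆ ℝ × ℝ` is open and symmetric and `X ⊆ ℝ`
is not the union of countably many `O`-free sets, then there is `X' ⊆ X` of
cardinality `ℵ₁` such that the partial order of finite `O`-homogeneous subsets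
of `X'` (ordered by reverse inclusion, with `a, b` compatible iff `a ∪ b` is
`O`-homogeneous) is ccc: every antichain is countable. -/
theorem stmt1 (hCH : Cardinal.continuum = Cardinal.aleph 1)
    (O : Set (ℝ × ℝ)) (hO : IsOpen O)
    (hsym : ∀ x y : ℝ, (x, y) ∈ O → (y, x) ∈ O) (X : Set ℝ)
    (hX : ¬ ∃ Y : ℕ → Set ℝ, X = (⋃ n, Y n) ∧ ∀ n, pairsSq (Y n) ∩ O = ∅) :
    ∃ X' : Set ℝ, X' ⊆ X ∧ Cardinal.mk X' = Cardinal.aleph 1 ∧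
      ∀ A : Set (Finset ℝ), (∀ a ∈ A, IsCond O X' a) →
        (∀ a ∈ A, ∀ b ∈ A, a ≠ b → ¬ pairsSq (↑(a ∪ b)) ⊆ O) →
        A.Countable := by
  obtain ⟨I, _, _, e, hcard, hI, he⟩ := exists_wellOrder_of_continuum_eq_aleph_one hCH
  obtain ⟨x, hinj, hxX, hx⟩ := exists_injective_genericFor hX hI he
  exact ⟨Set.range x, Set.range_subset_iff.2 hxX, (Cardinal.mk_range_eq x hinj).trans hcard,
    fun A hA hanti => hx.countable_of_antichain hI hO hsym hinj hA hanti⟩
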